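/- arXiv:2412.02448 — 4 statements merged into one kernel-verified Lean document; each statement's English description precedes it below -/
import Mathlib

section
/- Let (X, dist) be a metric space, q ∈ X, k a natural number, and let B ⊆ A be finite subsets of X. If K_A is a k-nearest-neighbor set of q in A and K_B is a k-nearest-neighbor set of q in B, then K_A ∩ B ⊆ K_B. In words: any element of the k nearest neighbors of q in the larger set A that happens to lie in the smaller set B is also among the k nearest neighbors of q in B. -/
/-- `IsKNN q k R K` : `K` is a k-nearest-neighbor set of `q` in the finite set `R`. -/
def IsKNN {X : Type*} [MetricSpace X] [DecidableEq X]
    (q : X) (k : ℕ) (R K : Finset X) : Prop :=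
  K ⊆ R ∧ K.card = min k R.card ∧ ∀ o ∈ K, ∀ u ∈ R \ K, dist o q < dist u q

/-- If `B ⊆ A`, any element of a k-nearest-neighbor set of `q` in `A` that lies in
`B` also belongs to any k-nearest-neighbor set of `q` in `B`. -/
theorem knn_inter_subset {X : Type*} [MetricSpace X] [DecidableEq X]
    (q : X) (k : ℕ) (A B KA KB : Finset X)
    (hBA : B ⊆ A) (hKA : IsKNN q k A KA) (hKB : IsKNN q k B KB) :
    KA ∩ B ⊆ KB := by
  obtain ⟨-, hcardA, hsepA⟩ := hKA
  obtain ⟨hsubB, hcardB, hsepB⟩ := hKB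
  intro x hx
  obtain ⟨hxA, hxB⟩ := Finset.mem_inter.mp hx
  by_contra hxKB
  have hlt : KB.card < B.card :=
    Finset.card_lt_card ((Finset.ssubset_iff_of_subset hsubB).mpr ⟨x, hxB, hxKB⟩)
  have hsub : insert x KB ⊆ KA := by
    refine Finset.insert_subset hxA fun o ho => ?_
    by_contra hoA
    exact lt_asymm (hsepB o ho x (Finset.mem_sdiff.mpr ⟨hxB, hxKB⟩))
      (hsepA x hxA o (Finset.mem_sdiff.mpr ⟨hBA (hsubB ho), hoA⟩))
  have hcard := Finset.card_le_card hsub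
  rw [Finset.card_insert_of_notMem hxKB] at hcard
  omega
end

section
/- (Lemma 1 of the paper.) Let (X, dist) be a metric space, k a natural number, and let D₁, D₂, …, D_r be pairwise disjoint finite subsets of X with union U = D₁ ∪ ⋯ ∪ D_r. Fix v ∈ U. Suppose K is a k-nearest-neighbor set of v in U \ {v}, and for each i ∈ {1, …, r}, K_i is a k-nearest-neighbor set of v in D_i \ {v}. Then K ⊆ K₁ ∪ K₂ ∪ ⋯ ∪ K_r; that is, kNN(v, U \ {v}) ⊆ ⋃_{i=1}^{r} kNN(v, D_i \ {v}). -/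
/-- A `k`-nearest neighbor of `q` in `S` that lies in a subset `R` of `S` is a `k`-nearest neighbor
of `q` in `R`. -/
theorem IsKNN.inter_subset {X : Type*} [MetricSpace X] [DecidableEq X] {q : X} {k : ℕ}
    {R S K L : Finset X} (hK : IsKNN q k S K) (hL : IsKNN q k R L) (hRS : R ⊆ S) :
    K ∩ R ⊆ L := by
  obtain ⟨-, hKcard, hKdist⟩ := hK
  obtain ⟨hLR, hLcard, hLdist⟩ := hL
  intro x hx
  obtain ⟨hxK, hxR⟩ := Finset.mem_inter.mp hx
  by_contra hxL
  have hLK : L ⊆ K := by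
    intro o ho
    by_contra hoK
    exact lt_asymm (hLdist o ho x (Finset.mem_sdiff.mpr ⟨hxR, hxL⟩))
      (hKdist x hxK o (Finset.mem_sdiff.mpr ⟨hRS (hLR ho), hoK⟩))
  have hlt_R : L.card < R.card :=
    Finset.card_lt_card ((Finset.ssubset_iff_of_subset hLR).mpr ⟨x, hxR, hxL⟩)
  have hlt_K : L.card < K.card :=
    Finset.card_lt_card ((Finset.ssubset_iff_of_subset hLK).mpr ⟨x, hxK, hxL⟩)
  omega

/-- Lemma 1: with `D₁, …, D_r` pairwise disjoint finite subsets with union `U` and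
`v ∈ U`, the k nearest neighbors of `v` in `U \ {v}` are contained in the union of
the per-subset k-nearest-neighbor sets of `v` in `D_i \ {v}`. -/
theorem knn_union_subset_biUnion {X : Type*} [MetricSpace X] [DecidableEq X]
    (k r : ℕ) (D : Fin r → Finset X)
    (hdisj : ∀ i j, i ≠ j → Disjoint (D i) (D j))
    (v : X) (hv : v ∈ Finset.univ.biUnion D)
    (K : Finset X) (hK : IsKNN v k ((Finset.univ.biUnion D) \ {v}) K)
    (Ki : Fin r → Finset X) (hKi : ∀ i, IsKNN v k ((D i) \ {v}) (Ki i)) :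
    K ⊆ Finset.univ.biUnion Ki := by
  intro x hx
  have hxU := hK.1 hx
  simp only [Finset.mem_sdiff, Finset.mem_biUnion, Finset.mem_univ, true_and] at hxU
  obtain ⟨⟨i, hi⟩, hxv⟩ := hxU
  have hsub : D i \ {v} ⊆ Finset.univ.biUnion D \ {v} :=
    Finset.sdiff_subset_sdiff (Finset.subset_biUnion_of_mem D (Finset.mem_univ i)) subset_rfl
  exact Finset.mem_biUnion.mpr ⟨i, Finset.mem_univ i, hK.inter_subset (hKi i) hsub
    (Finset.mem_inter.mpr ⟨hx, Finset.mem_sdiff.mpr ⟨hi, hxv⟩⟩)⟩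
end

section
/- Let (X, dist) be a metric space, k a natural number, and let D₁, D₂, …, D_r be pairwise disjoint finite subsets of X with union U = D₁ ∪ ⋯ ∪ D_r. Fix v ∈ U. Suppose K is a k-nearest-neighbor set of v in U \ {v}, and for each i ∈ {1, …, r}, K_i is a k-nearest-neighbor set of v in D_i \ {v}. Then K is itself a k-nearest-neighbor set of v in the candidate pool C = K₁ ∪ K₂ ∪ ⋯ ∪ K_r; in particular, the exact k nearest neighbors of v in U \ {v} can be recovered by merging the per-subset k-nearest-neighbor sets and taking the k nearest among them. -/
/-- A `k`-nearest-neighbor set of `q` in `R` is one in every intermediate set `K ⊆ C ⊆ R`. -/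
theorem IsKNN.of_subset {X : Type*} [MetricSpace X] [DecidableEq X] {q : X} {k : ℕ}
    {R C K : Finset X} (hK : IsKNN q k R K) (hKC : K ⊆ C) (hCR : C ⊆ R) : IsKNN q k C K := by
  obtain ⟨-, hcard, hsep⟩ := hK
  refine ⟨hKC, ?_, fun o ho u hu => hsep o ho u (Finset.sdiff_subset_sdiff hCR subset_rfl hu)⟩
  have hKC_card := Finset.card_le_card hKC
  have hCR_card := Finset.card_le_card hCR
  omega

/-- A `k`-nearest neighbor in `R` that lies in `S ⊆ R` is a `k`-nearest neighbor in `S`. -/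
theorem IsKNN.mem_of_mem_subset {X : Type*} [MetricSpace X] [DecidableEq X] {q : X} {k : ℕ}
    {R S K L : Finset X} (hK : IsKNN q k R K) (hL : IsKNN q k S L) (hSR : S ⊆ R)
    {o : X} (hoK : o ∈ K) (hoS : o ∈ S) : o ∈ L := by
  obtain ⟨-, hKcard, hKsep⟩ := hK
  obtain ⟨hLS, hLcard, hLsep⟩ := hL
  by_contra hoL
  have hLK : insert o L ⊆ K := by
    refine Finset.insert_subset hoK fun l hl => ?_
    by_contra hlK
    exact (hLsep l hl o (Finset.mem_sdiff.2 ⟨hoS, hoL⟩)).asymm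
      (hKsep o hoK l (Finset.mem_sdiff.2 ⟨hSR (hLS hl), hlK⟩))
  have hLK_card := Finset.card_le_card hLK
  have hLS_card := Finset.card_le_card (Finset.insert_subset hoS hLS)
  rw [Finset.card_insert_of_notMem hoL] at hLK_card hLS_card
  omega

/-- With `D₁, …, D_r` pairwise disjoint finite subsets with union `U` and `v ∈ U`,
the k-nearest-neighbor set `K` of `v` in `U \ {v}` is itself a k-nearest-neighbor
set of `v` in the merged candidate pool `C = K₁ ∪ ⋯ ∪ K_r` of per-subset
k-nearest-neighbor sets. -/
theorem knn_of_merged_candidates {X : Type*} [MetricSpace X] [DecidableEq X]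
    (k r : ℕ) (D : Fin r → Finset X)
    (hdisj : ∀ i j, i ≠ j → Disjoint (D i) (D j))
    (v : X) (hv : v ∈ Finset.univ.biUnion D)
    (K : Finset X) (hK : IsKNN v k ((Finset.univ.biUnion D) \ {v}) K)
    (Ki : Fin r → Finset X) (hKi : ∀ i, IsKNN v k ((D i) \ {v}) (Ki i)) :
    IsKNN v k (Finset.univ.biUnion Ki) K := by
  have hD : ∀ i, D i \ {v} ⊆ Finset.univ.biUnion D \ {v} := fun i =>
    Finset.sdiff_subset_sdiff (Finset.subset_biUnion_of_mem D (Finset.mem_univ i)) subset_rfl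
  refine hK.of_subset (fun o ho => ?_)
    (Finset.biUnion_subset.2 fun i _ => (hKi i).1.trans (hD i))
  obtain ⟨hoU, hov⟩ := Finset.mem_sdiff.1 (hK.1 ho)
  obtain ⟨i, hi, hoi⟩ := Finset.mem_biUnion.1 hoU
  exact Finset.mem_biUnion.2
    ⟨i, hi, hK.mem_of_mem_subset (hKi i) (hD i) ho (Finset.mem_sdiff.2 ⟨hoi, hov⟩)⟩
end

section
/- (Theorem 1 of the paper: inclusivity of SIG-kNNG.) Let (X, dist) be a metric space, k a natural number, and let a finite dataset D ⊆ X be partitioned into S pairwise disjoint subsets D₁, D₂, …, D_S. For each v ∈ D and each i ∈ {1, …, S}, let N_i(v) be a k-nearest-neighbor set of v in D_i \ {v}, and define the SIG-kNNG edge set E_F = { (v, o) : v ∈ D, o ∈ N_i(v) for some i }. Let i₁, i₂, …, i_r be r distinct indices from {1, …, S} (1 ≤ r ≤ S) and U = D_{i₁} ∪ ⋯ ∪ D_{i_r}. For each v ∈ U let N_U(v) be a k-nearest-neighbor set of v in U \ {v}, and define the kNNG edge set E_U = { (v, o) : v ∈ U, o ∈ N_U(v) }. Then E_U ⊆ E_F;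 that is, the k-nearest-neighbor graph of any union of segments is a sub-graph of the SIG-kNNG of D. -/
/-- A nearest neighbor in a larger set that lies in the smaller set is a nearest neighbor there. -/
theorem IsKNN.mem_of_subset {X : Type*} [MetricSpace X] [DecidableEq X]
    {q o : X} {k : ℕ} {R R' K K' : Finset X} (h : IsKNN q k R K) (h' : IsKNN q k R' K')
    (hR : R ⊆ R') (ho' : o ∈ K') (ho : o ∈ R) : o ∈ K := by
  obtain ⟨hKR, hcard, hlt⟩ := h
  obtain ⟨-, hcard', hlt'⟩ := h'
  by_contra hoK
  have hKK' : insert o K ⊆ K' := by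
    refine Finset.insert_subset ho' fun u hu => ?_
    by_contra huK'
    exact lt_asymm (hlt u hu o (Finset.mem_sdiff.2 ⟨ho, hoK⟩))
      (hlt' o ho' u (Finset.mem_sdiff.2 ⟨hR (hKR hu), huK'⟩))
  have hle := Finset.card_le_card hKK'
  have hleR := Finset.card_le_card (Finset.insert_subset ho hKR)
  rw [Finset.card_insert_of_notMem hoK] at hle hleR
  omega

/-- Theorem 1 (inclusivity of SIG-kNNG): the kNN graph of any union of segments
is a sub-graph of the segmented inclusive graph of `D`. -/
theorem sig_knng_inclusivity {X : Type*} [MetricSpace X] [DecidableEq X]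
    (k S : ℕ) (D : Finset X) (Dseg : Fin S → Finset X)
    (hdisj : ∀ i j, i ≠ j → Disjoint (Dseg i) (Dseg j))
    (hD : D = Finset.univ.biUnion Dseg)
    (N : X → Fin S → Finset X)
    (hN : ∀ v ∈ D, ∀ i, IsKNN v k ((Dseg i) \ {v}) (N v i))
    (r : ℕ) (hr1 : 1 ≤ r) (hrS : r ≤ S)
    (ι : Fin r → Fin S) (hι : Function.Injective ι)
    (NU : X → Finset X)
    (hNU : ∀ v ∈ Finset.univ.biUnion (fun j => Dseg (ι j)),
      IsKNN v k ((Finset.univ.biUnion (fun j => Dseg (ι j))) \ {v}) (NU v)) :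
    { p : X × X | p.1 ∈ Finset.univ.biUnion (fun j => Dseg (ι j)) ∧ p.2 ∈ NU p.1 } ⊆
      { p : X × X | p.1 ∈ D ∧ ∃ i, p.2 ∈ N p.1 i } := by
  rintro ⟨v, o⟩ ⟨hv, ho⟩
  have hvD : v ∈ D := by
    obtain ⟨j, -, hj⟩ := Finset.mem_biUnion.1 hv
    exact hD ▸ Finset.mem_biUnion.2 ⟨ι j, Finset.mem_univ _, hj⟩
  have hoU := Finset.mem_sdiff.1 ((hNU v hv).1 ho)
  obtain ⟨j, -, hj⟩ := Finset.mem_biUnion.1 hoU.1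
  exact ⟨hvD, ι j, (hN v hvD (ι j)).mem_of_subset (hNU v hv)
    (Finset.sdiff_subset_sdiff
      (Finset.subset_biUnion_of_mem (fun j => Dseg (ι j)) (Finset.mem_univ j)) subset_rfl)
    ho (Finset.mem_sdiff.2 ⟨hj, hoU.2⟩)⟩
end
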